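/- Let A > 0. Let X be uniformly distributed on the two-point set {−A, A} and let N be standard Gaussian, independent of X. Then the mutual information between X and Y = X + N equals A² − I(A), where I(A) = (2/(√(2π) A)) e^{−A²/2} ∫_0^∞ e^{−y²/(2A²)} cosh(y) ln(cosh(y)) dy. -/

import Mathlib

open MeasureTheory ProbabilityTheory Real Filter Set
open scoped Classical ENNReal NNReal

noncomputable section

/-- Kullback–Leibler divergence of `μ` from `ν` (valued in `EReal`; `⊤` when undefined). -/
def klDiv {α : Type*} [MeasurableSpace α] (μ ν : Measure α) : EReal :=
  if μ ≪ ν ∧ Integrable (llr μ ν) μ then ((∫ x, llr μ ν x ∂μ : ℝ) : EReal) else ⊤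

/-- Mutual information `I(U;V)` under `P`: the KL divergence of the joint law of `(U,V)`
from the product of its marginal laws. -/
def mutualInfo {Ω α β : Type*} [MeasurableSpace Ω] [MeasurableSpace α] [MeasurableSpace β]
    (P : Measure Ω) (U : Ω → α) (V : Ω → β) : EReal :=
  klDiv (P.map (fun ω => (U ω, V ω))) ((P.map U).prod (P.map V))

/-- `I(A) = (2/(√(2π) A)) e^{−A²/2} ∫_0^∞ e^{−y²/(2A²)} cosh(y) ln(cosh(y)) dy`. -/
def Ifun (A : ℝ) : ℝ :=
  2 / (Real.sqrt (2 * π) * A) * Real.exp (-A ^ 2 / 2) *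
    ∫ y in Set.Ioi (0 : ℝ), Real.exp (-y ^ 2 / (2 * A ^ 2)) * Real.cosh y * Real.log (Real.cosh y)

lemma log_cosh_nonneg (t : ℝ) : 0 ≤ Real.log (Real.cosh t) :=
  Real.log_nonneg (Real.one_le_cosh t)

lemma log_cosh_le_abs (t : ℝ) : Real.log (Real.cosh t) ≤ |t| := by
  rw [Real.log_le_iff_le_exp (Real.cosh_pos t), Real.cosh_eq]
  have h1 := Real.exp_le_exp.2 (le_abs_self t)
  have h2 := Real.exp_le_exp.2 (neg_le_abs t)
  linarith

lemma continuous_log_cosh_mul (A : ℝ) : Continuous fun y => Real.log (Real.cosh (A * y)) :=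
  Continuous.log (by fun_prop) fun y => (Real.cosh_pos _).ne'

lemma integrable_log_cosh_mul_gaussianReal (A m : ℝ) (v : ℝ≥0) :
    Integrable (fun y => Real.log (Real.cosh (A * y))) (gaussianReal m v) := by
  have h : Integrable (fun y : ℝ => A * y) (gaussianReal m v) :=
    ((memLp_id_gaussianReal 1).integrable le_rfl).const_mul A
  refine h.mono (continuous_log_cosh_mul A).aestronglyMeasurable (.of_forall fun y => ?_)
  rw [Real.norm_eq_abs, abs_of_nonneg (log_cosh_nonneg _)]
  exact log_cosh_le_abs _

/-- The density of the balanced mixture of the Gaussians centred at `±A`. -/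
lemma gaussianPDFReal_neg_add_gaussianPDFReal (A y : ℝ) :
    2⁻¹ * gaussianPDFReal (-A) 1 y + 2⁻¹ * gaussianPDFReal A 1 y =
      (√(2 * π))⁻¹ * Real.exp (-A ^ 2 / 2) * Real.exp (-y ^ 2 / 2) * Real.cosh (A * y) := by
  have h1 : Real.exp (-(y - -A) ^ 2 / 2) =
      Real.exp (-A ^ 2 / 2) * Real.exp (-y ^ 2 / 2) * Real.exp (-(A * y)) := by
    rw [← Real.exp_add, ← Real.exp_add]; ring_nf
  have h2 : Real.exp (-(y - A) ^ 2 / 2) =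
      Real.exp (-A ^ 2 / 2) * Real.exp (-y ^ 2 / 2) * Real.exp (A * y) := by
    rw [← Real.exp_add, ← Real.exp_add]; ring_nf
  simp only [gaussianPDFReal, NNReal.coe_one, mul_one, h1, h2, Real.cosh_eq]
  ring

lemma half_integral_gaussianReal_log_cosh (A : ℝ) (hA : 0 < A) :
    2⁻¹ * ∫ y, Real.log (Real.cosh (A * y)) ∂gaussianReal (-A) 1 +
      2⁻¹ * ∫ y, Real.log (Real.cosh (A * y)) ∂gaussianReal A 1 = Ifun A := by
  have hpdf (m : ℝ) : Integrable
      (fun y => gaussianPDFReal m 1 y * Real.log (Real.cosh (A * y))) := by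
    have h := integrable_log_cosh_mul_gaussianReal A m 1
    rw [gaussianReal_of_var_ne_zero m one_ne_zero, integrable_withDensity_iff_integrable_smul'
      (measurable_gaussianPDF m 1) (.of_forall fun _ => gaussianPDF_lt_top)] at h
    simpa [toReal_gaussianPDF] using h
  simp only [integral_gaussianReal_eq_integral_smul one_ne_zero, smul_eq_mul]
  rw [← integral_const_mul, ← integral_const_mul,
    ← integral_add ((hpdf _).const_mul _) ((hpdf _).const_mul _)]
  let F : ℝ → ℝ := fun y => Real.exp (-y ^ 2 / (2 * A ^ 2)) * Real.cosh y *
    Real.log (Real.cosh y)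
  have hF (y : ℝ) : 2⁻¹ * (gaussianPDFReal (-A) 1 y * Real.log (Real.cosh (A * y))) +
      2⁻¹ * (gaussianPDFReal A 1 y * Real.log (Real.cosh (A * y))) =
      (√(2 * π))⁻¹ * Real.exp (-A ^ 2 / 2) * F (A * |y|) := by
    have hc : Real.cosh (A * |y|) = Real.cosh (A * y) := by
      rw [← Real.cosh_abs (A * y), abs_mul, abs_of_pos hA]
    have he : -(A * |y|) ^ 2 / (2 * A ^ 2) = -y ^ 2 / 2 := by
      rw [mul_pow, sq_abs]; field_simp
    simp only [F, hc, he]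
    linear_combination Real.log (Real.cosh (A * y)) * gaussianPDFReal_neg_add_gaussianPDFReal A y
  simp_rw [hF]
  rw [integral_const_mul, integral_comp_abs (f := fun y => F (A * y)),
    integral_comp_mul_left_Ioi F 0 hA, mul_zero, Ifun, smul_eq_mul]
  simp only [F]
  field_simp

/-- Reweighting the balanced mixture of the Gaussians centred at `±A` to one of its components. -/
lemma mixture_withDensity (A x : ℝ) (hx : x ^ 2 = A ^ 2) :
    ((2 : ℝ≥0∞)⁻¹ • gaussianReal (-A) 1 + (2 : ℝ≥0∞)⁻¹ • gaussianReal A 1).withDensity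
      (fun y => ENNReal.ofReal (Real.exp (x * y) / Real.cosh (A * y))) = gaussianReal x 1 := by
  have h2 : (2 : ℝ≥0∞)⁻¹ = ENNReal.ofReal 2⁻¹ := by
    rw [ENNReal.ofReal_inv_of_pos two_pos]; simp
  have hm : Measurable fun y => ENNReal.ofReal (Real.exp (x * y) / Real.cosh (A * y)) := by
    fun_prop
  simp only [gaussianReal_of_var_ne_zero _ one_ne_zero]
  rw [← withDensity_smul _ (measurable_gaussianPDF _ _),
    ← withDensity_smul _ (measurable_gaussianPDF _ _),
    ← withDensity_add_left ((measurable_gaussianPDF _ _).const_smul _),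
    ← withDensity_mul _ (((measurable_gaussianPDF _ _).const_smul _).add
      ((measurable_gaussianPDF _ _).const_smul _)) hm]
  congr 1
  ext y
  have p1 := gaussianPDFReal_nonneg (-A) 1 y
  have p2 := gaussianPDFReal_nonneg A 1 y
  simp only [Pi.mul_apply, Pi.add_apply, Pi.smul_apply, smul_eq_mul, gaussianPDF, h2]
  rw [← ENNReal.ofReal_mul (by norm_num), ← ENNReal.ofReal_mul (by norm_num),
    ← ENNReal.ofReal_add (by positivity) (by positivity), ← ENNReal.ofReal_mul (by positivity),
    gaussianPDFReal_neg_add_gaussianPDFReal]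
  have hc := (Real.cosh_pos (A * y)).ne'
  have h1 : Real.exp (-(y - x) ^ 2 / 2) =
      Real.exp (-A ^ 2 / 2) * Real.exp (-y ^ 2 / 2) * Real.exp (x * y) := by
    rw [← Real.exp_add, ← Real.exp_add, ← hx]; ring_nf
  simp only [gaussianPDFReal, NNReal.coe_one, mul_one, h1]
  congr 1
  field_simp

/-- For `X` uniform on `{−A, A}` and `N` standard Gaussian independent of `X`,
`I(X; X + N) = A² − I(A)`. -/
theorem stmt10 (A : ℝ) (hA : 0 < A) :
    mutualInfo ((((2 : ℝ≥0∞)⁻¹ • Measure.dirac (-A) + (2 : ℝ≥0∞)⁻¹ • Measure.dirac A)).prod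
        (gaussianReal 0 1)) (fun ω => ω.1) (fun ω => ω.1 + ω.2) =
      ((A ^ 2 - Ifun A : ℝ) : EReal) := by
  set M : Measure ℝ := (2 : ℝ≥0∞)⁻¹ • gaussianReal (-A) 1 + (2 : ℝ≥0∞)⁻¹ • gaussianReal A 1
    with hM
  set U : Measure ℝ := (2 : ℝ≥0∞)⁻¹ • Measure.dirac (-A) + (2 : ℝ≥0∞)⁻¹ • Measure.dirac A with hU
  have : IsProbabilityMeasure M := ⟨by simp [hM, ENNReal.inv_two_add_inv_two]⟩
  have : IsProbabilityMeasure U := ⟨by simp [hU, ENNReal.inv_two_add_inv_two]⟩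
  have hprod (ν : Measure ℝ) [SFinite ν] : U.prod ν =
      (2 : ℝ≥0∞)⁻¹ • ν.map (Prod.mk (-A)) + (2 : ℝ≥0∞)⁻¹ • ν.map (Prod.mk A) := by
    rw [hU, Measure.add_prod, Measure.prod_smul_left, Measure.prod_smul_left,
      Measure.dirac_prod, Measure.dirac_prod]
  have hshift (x : ℝ) : (gaussianReal 0 1).map (fun n => x + n) = gaussianReal x 1 := by
    rw [gaussianReal_map_const_add, zero_add]
  have hfst : (U.prod (gaussianReal 0 1)).map (fun ω => ω.1) = U := by
    rw [Measure.map_fst_prod]; simp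
  have hsnd : (U.prod (gaussianReal 0 1)).map (fun ω => ω.1 + ω.2) = M := by
    rw [hprod, Measure.map_add _ _ (by fun_prop), Measure.map_smul, Measure.map_smul,
      Measure.map_map (by fun_prop) (by fun_prop), Measure.map_map (by fun_prop) (by fun_prop)]
    simp only [Function.comp_def, hshift, hM]
  have hjoint : (U.prod (gaussianReal 0 1)).map (fun ω => (ω.1, ω.1 + ω.2)) =
      (2 : ℝ≥0∞)⁻¹ • (gaussianReal (-A) 1).map (Prod.mk (-A)) +
        (2 : ℝ≥0∞)⁻¹ • (gaussianReal A 1).map (Prod.mk A) := by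
    rw [hprod, Measure.map_add _ _ (by fun_prop), Measure.map_smul, Measure.map_smul,
      Measure.map_map (by fun_prop) (by fun_prop), Measure.map_map (by fun_prop) (by fun_prop),
      ← hshift A, ← hshift (-A),
      Measure.map_map (by fun_prop) (by fun_prop), Measure.map_map (by fun_prop) (by fun_prop)]
    rfl
  let f : ℝ × ℝ → ℝ≥0∞ := fun p => ENNReal.ofReal (Real.exp (p.1 * p.2) / Real.cosh (A * p.2))
  have hf : Measurable f := by fun_prop
  have hmap (x : ℝ) (hx : x ^ 2 = A ^ 2) :
      (M.map (Prod.mk x)).withDensity f = (gaussianReal x 1).map (Prod.mk x) := by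
    rw [← mixture_withDensity A x hx]
    ext s hs
    rw [withDensity_apply _ hs, setLIntegral_map hs hf (by fun_prop),
      Measure.map_apply (by fun_prop) hs, withDensity_apply _ (hs.preimage (by fun_prop))]
  set J := (U.prod (gaussianReal 0 1)).map (fun ω => (ω.1, ω.1 + ω.2))
  have hdens : J = (U.prod M).withDensity f := by
    rw [hjoint, hprod, withDensity_add_measure, withDensity_smul_measure,
      withDensity_smul_measure, hmap _ (by ring), hmap _ rfl]
  have hac : J ≪ U.prod M := hdens ▸ withDensity_absolutelyContinuous _ _
  have hllr : llr J (U.prod M) =ᵐ[J] fun p => p.1 * p.2 - Real.log (Real.cosh (A * p.2)) := by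
    have h := Measure.rnDeriv_withDensity (U.prod M) hf
    rw [← hdens] at h
    filter_upwards [hac h] with p hp
    rw [llr, hp, ENNReal.toReal_ofReal (by positivity [Real.cosh_pos (A * p.2)]),
      Real.log_div (Real.exp_ne_zero _) (Real.cosh_pos _).ne', Real.log_exp]
  have hlin (x : ℝ) : Integrable (fun y : ℝ => x * y) (gaussianReal x 1) :=
    ((memLp_id_gaussianReal 1).integrable le_rfl).const_mul x
  have hgm : Measurable fun p : ℝ × ℝ => p.1 * p.2 - Real.log (Real.cosh (A * p.2)) := by
    fun_prop
  have hgi (x : ℝ) : Integrable (fun p : ℝ × ℝ => p.1 * p.2 - Real.log (Real.cosh (A * p.2)))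
      ((2 : ℝ≥0∞)⁻¹ • (gaussianReal x 1).map (Prod.mk x)) := by
    refine Integrable.smul_measure ?_ (by simp)
    rw [integrable_map_measure hgm.aestronglyMeasurable (by fun_prop)]
    exact (hlin x).sub (integrable_log_cosh_mul_gaussianReal A x 1)
  have hval (x : ℝ) : ∫ p : ℝ × ℝ, p.1 * p.2 - Real.log (Real.cosh (A * p.2))
      ∂((2 : ℝ≥0∞)⁻¹ • (gaussianReal x 1).map (Prod.mk x)) =
      2⁻¹ * (x ^ 2 - ∫ y, Real.log (Real.cosh (A * y)) ∂gaussianReal x 1) := by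
    rw [integral_smul_measure, integral_map (by fun_prop) hgm.aestronglyMeasurable,
      integral_sub (hlin x) (integrable_log_cosh_mul_gaussianReal A x 1), integral_const_mul,
      integral_id_gaussianReal]
    simp [sq]
  have hgJ : Integrable (fun p : ℝ × ℝ => p.1 * p.2 - Real.log (Real.cosh (A * p.2))) J := by
    rw [hjoint]
    exact (hgi _).add_measure (hgi _)
  rw [mutualInfo, hfst, hsnd, klDiv, if_pos ⟨hac, hgJ.congr hllr.symm⟩, integral_congr_ae hllr,
    hjoint, integral_add_measure (hgi _) (hgi _), hval, hval,
    ← half_integral_gaussianReal_log_cosh A hA]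
  congr 1
  ring

end
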